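/- arXiv:1804.05977 — 3 statements merged into one kernel-verified Lean document; each statement's English description precedes it below -/
import Mathlib

section
/- Let G be a finite nonempty type and let p, q be probability mass functions on G. If the L1 distance d = ∑ x, |p x − q x| satisfies 0 < d ≤ 1/2, then |H(p) − H(q)| ≤ d * Real.log (|G| / d), where |G| denotes the cardinality of G. -/
lemma aux_conc {s : Set ℝ} {f : ℝ → ℝ} (h : ConcaveOn ℝ s f) {x y a b : ℝ} (hx : x ∈ s)
    (hy : y ∈ s) (ha : 0 ≤ a) (hb : 0 ≤ b) (hab : a + b = 1) :
    a • f x + b • f y ≤ f (a • x + b • y) := h.2 hx hy ha hb hab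

open Real in
lemma aux_half {t : ℝ} (h0 : 0 ≤ t) (h1 : t ≤ 1/2) : negMulLog (1 - t) ≤ negMulLog t := by
  rcases h0.eq_or_lt with rfl | h0
  · simp
  have h2 : 0 < 1 - t := by linarith
  have hc := aux_conc strictConcaveOn_log_Ioi.concaveOn (x := t) (y := 1) h0 (by simp)
    (a := t / (1 - t)) (b := 1 - t / (1 - t)) (by positivity)
    (by rw [sub_nonneg, div_le_one h2]; linarith) (by ring)
  have e : t / (1 - t) * t + (1 - t / (1 - t)) * 1 = 1 - t := by field_simp; ring
  simp only [smul_eq_mul] at hc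
  rw [e, log_one, mul_zero, add_zero, div_mul_eq_mul_div, div_le_iff₀ h2] at hc
  simp only [negMulLog]
  linarith

open Real in
lemma aux_le {a t : ℝ} (ha : 0 ≤ a) (h0 : 0 ≤ t) (h1 : t ≤ 1/2) (hb : a + t ≤ 1) :
    |negMulLog (a + t) - negMulLog a| ≤ negMulLog t := by
  rcases h0.eq_or_lt with rfl | h0
  · simp
  rw [abs_sub_le_iff]
  constructor
  · rcases ha.eq_or_lt with rfl | ha
    · simp
    have e1 := mul_le_mul_of_nonneg_left (log_le_log ha (by linarith : a ≤ a + t)) ha.le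
    have e2 := mul_le_mul_of_nonneg_left (log_le_log h0 (by linarith : t ≤ a + t)) h0.le
    simp only [negMulLog]
    linarith
  · have hs : 0 < 1 - a := by linarith
    have hl : t / (1 - a) ≤ 1 := by rw [div_le_one hs]; linarith
    have hl0 : 0 ≤ t / (1 - a) := by positivity
    have c1 := aux_conc concaveOn_negMulLog (x := a) (y := 1) ha (by simp)
      (a := t / (1 - a)) (b := 1 - t / (1 - a)) hl0 (by linarith) (by ring)
    have c2 := aux_conc concaveOn_negMulLog (x := a) (y := 1) ha (by simp)
      (a := 1 - t / (1 - a)) (b := t / (1 - a)) (by linarith) hl0 (by ring)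
    have e1 : t / (1 - a) * a + (1 - t / (1 - a)) * 1 = 1 - t := by field_simp; ring
    have e2 : (1 - t / (1 - a)) * a + t / (1 - a) * 1 = a + t := by field_simp; ring
    simp only [smul_eq_mul] at c1 c2
    rw [e1, negMulLog_one] at c1
    rw [e2, negMulLog_one] at c2
    have := aux_half h0.le h1
    linarith

open Real in
lemma aux_abs {a b : ℝ} (ha : 0 ≤ a) (hb : 0 ≤ b) (ha1 : a ≤ 1) (hb1 : b ≤ 1)
    (h : |a - b| ≤ 1/2) : |negMulLog a - negMulLog b| ≤ negMulLog |a - b| := by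
  rcases le_total a b with hab | hab
  · rw [abs_sub_comm a b, abs_of_nonneg (sub_nonneg.2 hab)] at *
    have := aux_le ha (sub_nonneg.2 hab) h (by linarith)
    rw [abs_sub_comm]
    simpa using this
  · rw [abs_of_nonneg (sub_nonneg.2 hab)] at *
    have := aux_le hb (sub_nonneg.2 hab) h (by linarith)
    simpa using this

open Real in
lemma aux_log {x c : ℝ} (hx : 0 ≤ x) (hc : 0 < c) : negMulLog x ≤ x * log (1 / c) + (c - x) := by
  rcases hx.eq_or_lt with rfl | hx
  · simp [hc.le]
  have h := mul_le_mul_of_nonneg_left (log_le_sub_one_of_pos (div_pos hc hx)) hx.le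
  rw [log_div hc.ne' hx.ne'] at h
  have e : x * (c / x - 1) = c - x := by field_simp
  rw [e] at h
  simp only [negMulLog, one_div, log_inv]
  linarith

/-- For pmfs `p, q` on a finite nonempty type `G`, if the L1 distance
`d = ∑ x, |p x − q x|` satisfies `0 < d ≤ 1/2`, then
`|H(p) − H(q)| ≤ d * log (|G| / d)`, where entropy uses the natural log. -/
theorem entropy_continuity {G : Type*} [Fintype G] [Nonempty G]
    (p q : G → ℝ)
    (hp0 : ∀ x, 0 ≤ p x) (hp1 : ∑ x, p x = 1)
    (hq0 : ∀ x, 0 ≤ q x) (hq1 : ∑ x, q x = 1)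
    (hd0 : 0 < ∑ x, |p x - q x|) (hdhalf : (∑ x, |p x - q x|) ≤ 1 / 2) :
    |(∑ x, Real.negMulLog (p x)) - (∑ x, Real.negMulLog (q x))| ≤
      (∑ x, |p x - q x|) * Real.log ((Fintype.card G : ℝ) / (∑ x, |p x - q x|)) := by
  set d := ∑ x, |p x - q x| with hd
  have hn : (0 : ℝ) < Fintype.card G := by exact_mod_cast Fintype.card_pos
  have hp (x) : p x ≤ 1 := hp1 ▸ Finset.single_le_sum (fun i _ => hp0 i) (Finset.mem_univ x)
  have hq (x) : q x ≤ 1 := hq1 ▸ Finset.single_le_sum (fun i _ => hq0 i) (Finset.mem_univ x)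
  have hx (x) : |p x - q x| ≤ 1 / 2 := le_trans
    (Finset.single_le_sum (f := fun x => |p x - q x|) (fun i _ => abs_nonneg _)
      (Finset.mem_univ x)) hdhalf
  rw [← Finset.sum_sub_distrib]
  calc |∑ x, (Real.negMulLog (p x) - Real.negMulLog (q x))|
      ≤ ∑ x, |Real.negMulLog (p x) - Real.negMulLog (q x)| := Finset.abs_sum_le_sum_abs _ _
    _ ≤ ∑ x, (|p x - q x| * Real.log (1 / (d / Fintype.card G))
          + (d / Fintype.card G - |p x - q x|)) :=
        Finset.sum_le_sum fun x _ =>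
          (aux_abs (hp0 x) (hq0 x) (hp x) (hq x) (hx x)).trans
            (aux_log (abs_nonneg _) (div_pos hd0 hn))
    _ = d * Real.log (Fintype.card G / d) := by
        rw [Finset.sum_add_distrib, Finset.sum_sub_distrib, ← Finset.sum_mul, ← hd, one_div_div]
        simp only [Finset.sum_const, Finset.card_univ, nsmul_eq_mul]
        rw [mul_div_cancel₀ _ hn.ne']
        ring
end

section
/- For every m : ℕ, there exists a function f : (Fin m → ℚ) × ℕ → ℚ that is Computable (in the sense of Mathlib's Nat.Partrec-based computability theory, Fin m → ℚ being Primcodable) such that for every p : Fin m → ℚ with (p x : ℝ) ≥ 0 for all x and ∑ x, (p x : ℝ) = 1, and every n : ℕ, |(f (p, n) : ℝ) − H(fun x => (p x : ℝ))| ≤ 1 / (n + 1). That is, the Shannon entropy of a rational-valued probability mass function can be approximated to any prescribed accuracy by an algorithm. -/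
open Encodable
def c0 (q : ℚ) : ℕ := @encode ℚ Rat.instEncodable q
theorem c0_eq (q : ℚ) : c0 q = Nat.pair (encode q.num) q.den := rfl
theorem enc_int (z : ℤ) : encode z = if 0 ≤ z then 2 * z.toNat else 2 * (-z-1).toNat + 1 := by
  cases z with
  | ofNat a => 
    change 2 * a = _
    simp
  | negSucc a =>
    change 2 * a + 1 = _
    simp
theorem natAbs_enc (z : ℤ) : (encode z + 1) / 2 = z.natAbs := by
  rw [enc_int]; split_ifs <;> omega
theorem enc_even (z : ℤ) : encode z % 2 = 0 ↔ 0 ≤ z := by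
  rw [enc_int]; split_ifs <;> omega
theorem exists_enc (n : ℕ) : ∃ z : ℤ, encode z = n := by
  rcases Nat.even_or_odd' n with ⟨k, h | h⟩
  · exact ⟨k, by rw [enc_int]; split_ifs <;> omega⟩
  · exact ⟨-k-1, by rw [enc_int]; split_ifs <;> omega⟩
theorem mem_s (x : ℕ) : (∃ q, c0 q = x) ↔
    (0 < x.unpair.2 ∧ Nat.Coprime ((x.unpair.1 + 1) / 2) x.unpair.2) := by
  constructor
  · rintro ⟨q, rfl⟩
    rw [c0_eq, Nat.unpair_pair]
    simp only [natAbs_enc]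
    exact ⟨q.den_pos, q.reduced⟩
  · rintro ⟨h1, h2⟩
    obtain ⟨z, hz⟩ := exists_enc x.unpair.1
    rw [← hz, natAbs_enc] at h2
    refine ⟨⟨z, x.unpair.2, h1.ne', h2⟩, ?_⟩
    rw [c0_eq, hz]; simp

theorem c0_succ (n : ℕ) : c0 (Denumerable.ofNat ℚ n) < c0 (Denumerable.ofNat ℚ (n+1)) ∧
    ∀ y, (∃ q, c0 q = y) → c0 (Denumerable.ofNat ℚ n) < y → c0 (Denumerable.ofNat ℚ (n+1)) ≤ y := by
  let := @decidableRangeEncode ℚ Rat.instEncodable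
  let : Infinite (Set.range (@encode ℚ Rat.instEncodable)) :=
    Infinite.of_injective _ (Equiv.ofInjective _ encode_injective).injective
  have key : ∀ n, c0 (Denumerable.ofNat ℚ n) =
      (Nat.Subtype.ofNat (Set.range (@encode ℚ Rat.instEncodable)) n : ℕ) := by
    intro n
    have : Denumerable.ofNat ℚ n = (@equivRangeEncode ℚ Rat.instEncodable).symm
      (Nat.Subtype.ofNat (Set.range (@encode ℚ Rat.instEncodable)) n) := by
      rfl
    rw [this]
    have h2 := (@equivRangeEncode ℚ Rat.instEncodable).apply_symm_apply (Nat.Subtype.ofNat (Set.range (@encode ℚ Rat.instEncodable)) n)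
    exact congrArg Subtype.val h2
  simp only [key]
  refine ⟨Nat.Subtype.lt_succ_self _, ?_⟩
  intro y hy h
  exact Nat.Subtype.succ_le_of_lt (x := (⟨y, hy⟩ : Set.range (@encode ℚ Rat.instEncodable))) h

theorem comp_find {α β : Type} [Primcodable α] [Primcodable β] {P : β → Prop} {g : α × ℕ → β}
    (hP : PrimrecPred P) (hg : Computable g) (h : ∀ a, ∃ n, P (g (a, n))) :
    ∃ F : α → ℕ, Computable F ∧ ∀ a, P (g (a, F a)) ∧ ∀ n < F a, ¬ P (g (a, n)) := by
  classical
  refine ⟨fun a => Nat.find (h a), ?_, fun a =>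
    ⟨Nat.find_spec (h a), fun n hn => Nat.find_min (h a) hn⟩⟩
  have hp : Computable fun x : α × ℕ => decide (P (g x)) :=
    (primrecPred_iff_primrec_decide.1 hP).to_comp.comp hg
  have hp2 : Partrec₂ (fun (a : α) => ((fun n => decide (P (g (a, n))) : ℕ → Bool) : ℕ →. Bool)) := hp
  refine Partrec.of_eq (Partrec.rfind hp2) fun a => ?_
  refine Part.eq_some_iff.2 (Nat.mem_rfind.2 ⟨?_, fun {m} hm => ?_⟩)
  · simpa using Nat.find_spec (h a)
  · simpa using Nat.find_min (h a) hm

theorem coprime_iff' (a b : ℕ) : (0 < b ∧ Nat.Coprime a b) ↔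
    (0 < b ∧ ∀ k < b + 1, ¬ (a % k = 0 ∧ b % k = 0) ∨ k = 1) := by
  refine and_congr_right fun hb => ?_
  constructor
  · intro h k _
    by_cases hk : a % k = 0 ∧ b % k = 0
    · right
      exact Nat.eq_one_of_dvd_coprimes h (Nat.dvd_of_mod_eq_zero hk.1) (Nat.dvd_of_mod_eq_zero hk.2)
    · exact Or.inl hk
  · intro h
    rcases h (Nat.gcd a b) (Nat.lt_succ_of_le (Nat.gcd_le_right _ hb)) with h | h
    · exact absurd ⟨Nat.mod_eq_zero_of_dvd (Nat.gcd_dvd_left _ _),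
        Nat.mod_eq_zero_of_dvd (Nat.gcd_dvd_right _ _)⟩ h
    · exact h

theorem prim_coprime : PrimrecPred fun x : ℕ × ℕ => 0 < x.2 ∧ Nat.Coprime x.1 x.2 := by
  have hR : PrimrecRel fun (k : ℕ) (y : ℕ × ℕ) => ¬ (y.1 % k = 0 ∧ y.2 % k = 0) ∨ k = 1 := by
    have h1 : PrimrecPred fun z : ℕ × (ℕ × ℕ) => z.2.1 % z.1 = 0 :=
      Primrec.eq.comp (Primrec.nat_mod.comp (Primrec.fst.comp Primrec.snd) Primrec.fst)
        (Primrec.const 0)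
    have h2 : PrimrecPred fun z : ℕ × (ℕ × ℕ) => z.2.2 % z.1 = 0 :=
      Primrec.eq.comp (Primrec.nat_mod.comp (Primrec.snd.comp Primrec.snd) Primrec.fst)
        (Primrec.const 0)
    have h3 : PrimrecPred fun z : ℕ × (ℕ × ℕ) => z.1 = 1 :=
      Primrec.eq.comp Primrec.fst (Primrec.const 1)
    exact ((h1.and h2).not).or h3
  have h4 := (PrimrecRel.forall_mem_list hR).comp
    (Primrec.list_range.comp (Primrec.succ.comp (Primrec.snd (α := ℕ) (β := ℕ))))
    (Primrec.pair (Primrec.fst (α := ℕ) (β := ℕ)) Primrec.snd)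
  have h5 : PrimrecPred fun x : ℕ × ℕ => 0 < x.2 :=
    Primrec.nat_lt.comp (Primrec.const 0) Primrec.snd
  exact (h5.and h4).of_eq fun x => by rw [coprime_iff']; simp [List.mem_range]

theorem prim_s : PrimrecPred fun x : ℕ => ∃ q, c0 q = x := by
  have h1 : Primrec fun x : ℕ => (((x.unpair.1 + 1) / 2, x.unpair.2) : ℕ × ℕ) :=
    Primrec.pair (Primrec.nat_div.comp (Primrec.succ.comp (Primrec.fst.comp Primrec.unpair))
      (Primrec.const 2)) (Primrec.snd.comp Primrec.unpair)
  exact (prim_coprime.comp h1).of_eq fun x => (mem_s x).symm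

theorem comp_c0_ofNat : Computable fun n : ℕ => c0 (Denumerable.ofNat ℚ n) := by
  classical
  have hex : ∀ x : ℕ, ∃ y, x < y ∧ ∃ q, c0 q = y := fun x => by
    refine ⟨c0 ((x + 1 : ℕ) : ℚ), ?_, _, rfl⟩
    rw [c0_eq]
    refine lt_of_lt_of_le ?_ (Nat.left_le_pair _ _)
    have : ((x + 1 : ℕ) : ℚ).num = ((x + 1 : ℕ) : ℤ) := Rat.num_natCast _
    rw [this, enc_int]
    split_ifs <;> omega
  have hp : PrimrecPred fun z : ℕ × ℕ => z.1 < z.2 ∧ ∃ q, c0 q = z.2 :=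
    (Primrec.nat_lt.comp Primrec.fst Primrec.snd).and (prim_s.comp Primrec.snd)
  obtain ⟨F, hF, hF2⟩ := comp_find hp (Computable.id (α := ℕ × ℕ)) hex
  have := Computable.nat_rec (f := fun n : ℕ => n) (g := fun _ => c0 (Denumerable.ofNat ℚ 0))
    (h := fun _ z => F z.2) Computable.id (Computable.const _)
    (hF.comp (Computable.snd.comp Computable.snd))
  refine this.of_eq fun n => ?_
  induction n with
  | zero => rfl
  | succ n ih =>
    simp only at ih ⊢
    rw [ih]
    obtain ⟨h1, h2⟩ := c0_succ n
    obtain ⟨h3, h4⟩ := hF2 (c0 (Denumerable.ofNat ℚ n))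
    apply le_antisymm
    · by_contra hlt
      exact h4 _ (not_le.1 hlt) ⟨h1, _, rfl⟩
    · exact h2 _ h3.2 h3.1

theorem comp_c0 : Computable c0 :=
  (comp_c0_ofNat.comp Computable.encode).of_eq fun q => by rw [Denumerable.ofNat_encode]

theorem comp_den : Computable fun q : ℚ => q.den :=
  ((Primrec.snd.comp Primrec.unpair).to_comp.comp comp_c0).of_eq fun q => by simp [c0_eq]

theorem comp_encnum : Computable fun q : ℚ => encode q.num :=
  ((Primrec.fst.comp Primrec.unpair).to_comp.comp comp_c0).of_eq fun q => by simp [c0_eq]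

theorem comp_natAbs : Computable fun q : ℚ => q.num.natAbs :=
  ((Primrec.nat_div.comp Primrec.succ (Primrec.const 2)).to_comp.comp comp_encnum).of_eq
    fun q => natAbs_enc q.num

theorem comp_div : Computable fun x : ℕ × ℕ => ((x.1 : ℚ) / ((x.2 + 1 : ℕ) : ℚ)) := by
  classical
  have hiff : ∀ (x : ℕ × ℕ) (q : ℚ), (encode q.num % 2 = 0 ∧ q.num.natAbs * (x.2 + 1) = x.1 * q.den) ↔
      q = (x.1 : ℚ) / ((x.2 + 1 : ℕ) : ℚ) := by
    intro x q
    have hM : ((x.2 + 1 : ℕ) : ℚ) ≠ 0 := by positivity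
    have hd : (q.den : ℚ) ≠ 0 := by exact_mod_cast q.den_pos.ne'
    have hq : q * q.den = q.num := Rat.mul_den_eq_num q
    rw [enc_even, eq_div_iff hM]
    constructor
    · rintro ⟨h0, h⟩
      have h' : ((q.num.natAbs : ℤ) : ℚ) * ((x.2 + 1 : ℕ) : ℚ) = x.1 * q.den := by exact_mod_cast h
      rw [Int.natAbs_of_nonneg h0, ← hq] at h'
      apply mul_right_cancel₀ hd
      linarith
    · intro h
      have hq0 : 0 ≤ q := by
        rw [(eq_div_iff hM).2 h]; positivity
      have h0 : 0 ≤ q.num := Rat.num_nonneg.2 hq0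
      refine ⟨h0, ?_⟩
      have h' : ((q.num.natAbs : ℤ) : ℚ) * ((x.2 + 1 : ℕ) : ℚ) = x.1 * q.den := by
        rw [Int.natAbs_of_nonneg h0, ← hq, ← h]; ring
      exact_mod_cast h'
  have hex : ∀ x : ℕ × ℕ, ∃ n, (encode (Denumerable.ofNat ℚ n).num % 2 = 0 ∧
      (Denumerable.ofNat ℚ n).num.natAbs * (x.2 + 1) = x.1 * (Denumerable.ofNat ℚ n).den) := by
    intro x
    refine ⟨Denumerable.eqv ℚ ((x.1 : ℚ) / ((x.2 + 1 : ℕ) : ℚ)), ?_⟩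
    rw [hiff]
    exact Denumerable.ofNat_encode _
  have hN : Computable fun z : (ℕ × ℕ) × ℕ => Denumerable.ofNat ℚ z.2 :=
    (Computable.ofNat ℚ).comp Computable.snd
  have e1 : PrimrecPred fun w : ℕ × ℕ × ℕ × ℕ × ℕ =>
      w.1 % 2 = 0 ∧ w.2.1 * (w.2.2.2.2 + 1) = w.2.2.2.1 * w.2.2.1 := by
    refine PrimrecPred.and (Primrec.eq.comp (Primrec.nat_mod.comp Primrec.fst (Primrec.const 2))
      (Primrec.const 0)) (Primrec.eq.comp ?_ ?_)
    · exact Primrec.nat_mul.comp (Primrec.fst.comp Primrec.snd) (Primrec.succ.comp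
        (Primrec.snd.comp (Primrec.snd.comp (Primrec.snd.comp Primrec.snd))))
    · exact Primrec.nat_mul.comp (Primrec.fst.comp (Primrec.snd.comp (Primrec.snd.comp Primrec.snd)))
        (Primrec.fst.comp (Primrec.snd.comp Primrec.snd))
  have e2 : Computable fun z : (ℕ × ℕ) × ℕ => ((encode (Denumerable.ofNat ℚ z.2).num,
      (Denumerable.ofNat ℚ z.2).num.natAbs, (Denumerable.ofNat ℚ z.2).den, z.1.1, z.1.2) :
        ℕ × ℕ × ℕ × ℕ × ℕ) :=
    (comp_encnum.comp hN).pair ((comp_natAbs.comp hN).pair ((comp_den.comp hN).pair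
      ((Computable.fst.comp Computable.fst).pair (Computable.snd.comp Computable.fst))))
  obtain ⟨F, hF, hF2⟩ := comp_find e1 e2 hex
  exact ((Computable.ofNat ℚ).comp hF).of_eq fun x => (hiff x _).1 (hF2 x).1

theorem prim_pow : Primrec₂ ((· ^ ·) : ℕ → ℕ → ℕ) := Primrec₂.unpaired'.1 Nat.Primrec.pow

theorem exists_k (M a d : ℕ) (hd : 0 < d) :
    ∃ k, (M + 1) ^ (k * d) * d ^ a ≤ (M + 2) ^ (k * d) * a ^ a := by
  have hM : (0:ℝ) < M + 1 := by positivity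
  have hb : (1 : ℝ) < (M + 2) / (M + 1) := by rw [lt_div_iff₀ hM]; linarith
  obtain ⟨k, hk⟩ := pow_unbounded_of_one_lt ((d : ℝ) ^ a) hb
  refine ⟨k, ?_⟩
  have h1 : (d : ℝ) ^ a ≤ ((M + 2) / (M + 1)) ^ (k * d) :=
    hk.le.trans (pow_le_pow_right₀ hb.le (Nat.le_mul_of_pos_right k hd))
  rw [div_pow, le_div_iff₀ (by positivity)] at h1
  have h2 : (M + 1) ^ (k * d) * d ^ a ≤ (M + 2) ^ (k * d) := by
    have : ((M : ℝ) + 1) ^ (k * d) * d ^ a ≤ (M + 2) ^ (k * d) := by linarith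
    exact_mod_cast this
  have h3 : 1 ≤ a ^ a := by
    rcases Nat.eq_zero_or_pos a with rfl | h
    · simp
    · exact Nat.one_le_pow _ _ h
  exact h2.trans (Nat.le_mul_of_pos_right _ h3)

theorem comp_kk : ∃ K : ℚ × ℕ → ℕ, Computable K ∧ ∀ (q : ℚ) (M : ℕ),
    ((M + 1) ^ (K (q, M) * q.den) * q.den ^ q.num.natAbs ≤
      (M + 2) ^ (K (q, M) * q.den) * q.num.natAbs ^ q.num.natAbs) ∧
    ∀ n < K (q, M), ¬ ((M + 1) ^ (n * q.den) * q.den ^ q.num.natAbs ≤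
      (M + 2) ^ (n * q.den) * q.num.natAbs ^ q.num.natAbs) := by
  -- variables: M, a, d, k
  have e1 : PrimrecPred fun w : ℕ × ℕ × ℕ × ℕ =>
      (w.1 + 1) ^ (w.2.2.2 * w.2.2.1) * w.2.2.1 ^ w.2.1 ≤
        (w.1 + 2) ^ (w.2.2.2 * w.2.2.1) * w.2.1 ^ w.2.1 := by
    have hM : Primrec fun w : ℕ × ℕ × ℕ × ℕ => w.1 := Primrec.fst
    have ha : Primrec fun w : ℕ × ℕ × ℕ × ℕ => w.2.1 := Primrec.fst.comp Primrec.snd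
    have hd : Primrec fun w : ℕ × ℕ × ℕ × ℕ => w.2.2.1 :=
      Primrec.fst.comp (Primrec.snd.comp Primrec.snd)
    have hk : Primrec fun w : ℕ × ℕ × ℕ × ℕ => w.2.2.2 :=
      Primrec.snd.comp (Primrec.snd.comp Primrec.snd)
    refine Primrec.nat_le.comp ?_ ?_
    · exact Primrec.nat_mul.comp (prim_pow.comp (Primrec.succ.comp hM) (Primrec.nat_mul.comp hk hd))
        (prim_pow.comp hd ha)
    · exact Primrec.nat_mul.comp (prim_pow.comp (Primrec.succ.comp (Primrec.succ.comp hM))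
        (Primrec.nat_mul.comp hk hd)) (prim_pow.comp ha ha)
  have hq : Computable fun z : (ℚ × ℕ) × ℕ => z.1.1 := Computable.fst.comp Computable.fst
  have e2 : Computable fun z : (ℚ × ℕ) × ℕ =>
      ((z.1.2, z.1.1.num.natAbs, z.1.1.den, z.2) : ℕ × ℕ × ℕ × ℕ) :=
    (Computable.snd.comp Computable.fst).pair ((comp_natAbs.comp hq).pair
      ((comp_den.comp hq).pair Computable.snd))
  obtain ⟨F, hF, hF2⟩ := comp_find e1 e2
    fun x : ℚ × ℕ => exists_k x.2 x.1.num.natAbs x.1.den x.1.den_pos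
  exact ⟨F, hF, fun q M => hF2 (q, M)⟩

theorem kk_spec (q : ℚ) (M k : ℕ) (h0 : 0 ≤ q) (h1 : q ≤ 1)
    (hk : ((M + 1) ^ (k * q.den) * q.den ^ q.num.natAbs ≤
      (M + 2) ^ (k * q.den) * q.num.natAbs ^ q.num.natAbs))
    (hk' : ∀ n < k, ¬ ((M + 1) ^ (n * q.den) * q.den ^ q.num.natAbs ≤
      (M + 2) ^ (n * q.den) * q.num.natAbs ^ q.num.natAbs)) :
    |(k : ℝ) / (M + 1) - Real.negMulLog (q : ℝ)| ≤ 3 / (M + 1) := by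
  have hM : (0:ℝ) < M + 1 := by positivity
  set b : ℝ := Real.log ((M + 2) / (M + 1)) with hb
  have hb1 : b ≤ 1 / (M + 1) := by
    have := Real.log_le_sub_one_of_pos (show (0:ℝ) < (M + 2) / (M + 1) by positivity)
    refine this.trans (le_of_eq ?_)
    field_simp; ring
  have hb2 : 1 / (M + 2 : ℝ) ≤ b := by
    have := Real.one_sub_inv_le_log_of_pos (show (0:ℝ) < (M + 2) / (M + 1) by positivity)
    refine le_trans (le_of_eq ?_) this
    field_simp; ring
  have hd : (0:ℝ) < q.den := by exact_mod_cast q.den_pos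
  have hq : (q : ℝ) = (q.num.natAbs : ℝ) / q.den := by
    have h : ((q.num.natAbs : ℤ) : ℝ) = q.num := by
      rw [Int.natAbs_of_nonneg (Rat.num_nonneg.2 h0)]
    rw [Rat.cast_def, ← h, Int.cast_natCast]
  have hent : ∀ n : ℕ, ((M + 1) ^ (n * q.den) * q.den ^ q.num.natAbs ≤
      (M + 2) ^ (n * q.den) * q.num.natAbs ^ q.num.natAbs) ↔ Real.negMulLog (q : ℝ) ≤ n * b := by
    intro n
    have haa : (0:ℝ) < (q.num.natAbs : ℝ) ^ q.num.natAbs := by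
      rcases Nat.eq_zero_or_pos q.num.natAbs with h | h
      · simp [h]
      · positivity
    have hl : Real.log ((q.num.natAbs : ℝ) ^ q.num.natAbs) - Real.log ((q.den : ℝ) ^ q.num.natAbs)
        = - q.den * Real.negMulLog (q : ℝ) := by
      rw [Real.log_pow, Real.log_pow, hq, Real.negMulLog]
      rcases Nat.eq_zero_or_pos q.num.natAbs with h | h
      · simp [h]
      · rw [Real.log_div (by positivity) hd.ne']
        field_simp
    have hbl : b = Real.log (M + 2) - Real.log (M + 1) := by
      rw [hb, Real.log_div (by positivity) (by positivity)]
    have : ((M + 1) ^ (n * q.den) * q.den ^ q.num.natAbs ≤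
      (M + 2) ^ (n * q.den) * q.num.natAbs ^ q.num.natAbs) ↔
      ((M + 1 : ℝ) ^ (n * q.den) * (q.den : ℝ) ^ q.num.natAbs ≤
      (M + 2 : ℝ) ^ (n * q.den) * (q.num.natAbs : ℝ) ^ q.num.natAbs) := by exact_mod_cast Iff.rfl
    rw [this, ← Real.log_le_log_iff (by positivity) (by positivity),
      Real.log_mul (by positivity) (by positivity), Real.log_mul (by positivity) haa.ne',
      Real.log_pow (M + 1 : ℝ), Real.log_pow (M + 2 : ℝ), ← mul_le_mul_iff_right₀ hd (b := Real.negMulLog (q : ℝ)), hbl]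
    push_cast
    constructor <;> intro h <;> nlinarith
  rw [hent] at hk
  have hq0 : (0:ℝ) ≤ q := by exact_mod_cast h0
  have hq1 : (q:ℝ) ≤ 1 := by exact_mod_cast h1
  set H := Real.negMulLog (q : ℝ) with hH
  have hH1 : H ≤ 1 := by
    rcases hq0.eq_or_lt with h | h
    · rw [hH, ← h]; simp
    · have := Real.one_sub_inv_le_log_of_pos h
      have h2 := mul_le_mul_of_nonneg_left this h.le
      rw [mul_sub, mul_inv_cancel₀ h.ne'] at h2
      rw [hH, Real.negMulLog]; linarith
  have hH0 : 0 ≤ H := Real.negMulLog_nonneg hq0 hq1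
  have hkb : (k:ℝ) * b ≤ H + b := by
    rcases Nat.eq_zero_or_pos k with h | h
    · have : 0 ≤ b := le_trans (by positivity) hb2
      simp [h]; linarith
    · have := hk' (k - 1) (by omega)
      rw [hent, not_le, Nat.cast_sub h] at this
      push_cast at this
      linarith
  have hk0 : (0:ℝ) ≤ k := k.cast_nonneg
  have u1 : (k:ℝ) * b ≤ k / (M + 1) := by
    calc (k:ℝ) * b ≤ k * (1 / (M + 1)) := by gcongr
      _ = _ := by ring
  have u2 : (k:ℝ) / (M + 2) ≤ H + 1 / (M + 1) := by
    calc (k:ℝ) / (M + 2) = k * (1 / (M + 2)) := by ring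
      _ ≤ k * b := by gcongr
      _ ≤ _ := by linarith
  have u3 : (k:ℝ) / (M + 1) ≤ H + 3 / (M + 1) := by
    have e : (k:ℝ) / (M + 1) = k / (M + 2) * (1 + 1 / (M + 1)) := by field_simp; ring
    have t0 : (0:ℝ) ≤ 1 / (M + 1) := by positivity
    have t1 : (1:ℝ) / (M + 1) ≤ 1 := by
      rw [div_le_one hM]; linarith [(Nat.cast_nonneg M : (0:ℝ) ≤ M)]
    have e3 : (3:ℝ) / (M + 1) = 3 * (1 / (M + 1)) := by ring
    rw [e, e3]
    set t := (1:ℝ) / (M + 1)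
    calc (k:ℝ) / (M + 2) * (1 + t) ≤ (H + t) * (1 + t) := by gcongr
      _ ≤ H + 3 * t := by nlinarith
  rw [abs_le]
  have : (0:ℝ) ≤ 3 / (M + 1) := by positivity
  constructor <;> linarith

theorem comp_sum {α : Type} [Primcodable α] {ι : Type} (s : Finset ι) (g : ι → α → ℕ)
    (hg : ∀ i, Computable (g i)) : Computable fun a => ∑ i ∈ s, g i a := by
  classical
  induction s using Finset.induction_on with
  | empty => simpa using Computable.const 0
  | insert i s hi ih =>
    simp only [Finset.sum_insert hi]
    exact Primrec.nat_add.to_comp.comp (hg i) ih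

theorem entropy_computably_approximable (m : ℕ) :
    ∃ f : (Fin m → ℚ) × ℕ → ℚ, Computable f ∧
      ∀ p : Fin m → ℚ, (∀ x, (0 : ℝ) ≤ (p x : ℝ)) → (∑ x, (p x : ℝ)) = 1 →
        ∀ n : ℕ,
          |(f (p, n) : ℝ) - ∑ x, Real.negMulLog ((p x : ℝ))| ≤ 1 / (n + 1) := by
  obtain ⟨K, hK, hK2⟩ := comp_kk
  have hM : Computable fun x : (Fin m → ℚ) × ℕ => 3 * m * (x.2 + 1) :=
    (Primrec.nat_mul.comp (Primrec.const (3 * m)) (Primrec.succ.comp Primrec.snd)).to_comp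
  have hS : Computable fun x : (Fin m → ℚ) × ℕ => ∑ i, K (x.1 i, 3 * m * (x.2 + 1)) :=
    comp_sum Finset.univ (fun i (x : (Fin m → ℚ) × ℕ) => K (x.1 i, 3 * m * (x.2 + 1))) fun i =>
      hK.comp ((Computable.fin_app.comp Computable.fst (Computable.const i)).pair hM)
  refine ⟨_, comp_div.comp (hS.pair hM), fun p hp0 hp1 n => ?_⟩
  simp only
  have hle : ∀ i, p i ≤ 1 := fun i => by
    have : (p i : ℝ) ≤ 1 := hp1 ▸ Finset.single_le_sum (f := fun i => (p i : ℝ))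
      (fun j _ => hp0 j) (Finset.mem_univ i)
    exact_mod_cast this
  have h0 : ∀ i, 0 ≤ p i := fun i => by exact_mod_cast hp0 i
  set M := 3 * m * (n + 1) with hMdef
  push_cast
  rw [Finset.sum_div, ← Finset.sum_sub_distrib]
  refine (Finset.abs_sum_le_sum_abs _ _).trans
    ((Finset.sum_le_sum fun i _ => kk_spec (p i) M _ (h0 i) (hle i) (hK2 (p i) M).1 (hK2 (p i) M).2).trans ?_)
  simp only [Finset.sum_const, Finset.card_univ, Fintype.card_fin, nsmul_eq_mul]
  rw [← mul_div_assoc, div_le_div_iff₀ (by positivity) (by positivity)]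
  have : (M : ℝ) = 3 * m * (n + 1) := by rw [hMdef]; push_cast; ring
  rw [this]
  linarith
end

section
/- For all a, b, c : ℕ, there exists a function f : (Fin a × Fin b × Fin c → ℚ) × ℕ → ℚ that is Computable (in the sense of Mathlib's computability theory) such that for every p : Fin a × Fin b × Fin c → ℚ whose real coercion is a probability mass function on Fin a × Fin b × Fin c, and every n : ℕ, |(f (p, n) : ℝ) − I_p(X;Y|Z)| ≤ 1 / (n + 1), where I_p(X;Y|Z) is the conditional mutual information of the real-valued pmf fun g => (p g : ℝ). That is, conditional mutual information of rational-valued joint distributions can be approximated to any prescribed accuracy by an algorithm. -/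
/-- The conditional mutual information `I_p(X;Y|Z) = H(p_XZ) + H(p_YZ) − H(p_Z) − H(p)`
of a joint distribution `p` on `X × Y × Z`, with entropy in nats. -/
noncomputable def condMutualInfo {X Y Z : Type*} [Fintype X] [Fintype Y] [Fintype Z]
    (p : X × Y × Z → ℝ) : ℝ :=
  (∑ x, ∑ z, Real.negMulLog (∑ y, p (x, y, z))) +
    (∑ y, ∑ z, Real.negMulLog (∑ x, p (x, y, z))) -
    (∑ z, Real.negMulLog (∑ x, ∑ y, p (x, y, z))) -
    (∑ g, Real.negMulLog (p g))

instance (a b c : ℕ) : Primcodable (Fin a × Fin b × Fin c → ℚ) :=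
  Primcodable.ofEquiv (Fin (a * (b * c)) → ℚ)
    (Equiv.arrowCongr
      (((Equiv.prodCongr (Equiv.refl (Fin a)) finProdFinEquiv).trans finProdFinEquiv))
      (Equiv.refl ℚ))

open Encodable

def ratIota (q : ℚ) : ℕ := Nat.pair (encode q.num) q.den
def RatR (m : ℕ) : Prop := 0 < m.unpair.2 ∧ Nat.Coprime ((m.unpair.1 + 1) / 2) m.unpair.2
instance : DecidablePred RatR := fun m => by unfold RatR; infer_instance

theorem ratEnc (q : ℚ) : @encode ℚ Rat.instEncodable q = ratIota q := rfl

/-- The code of a rational under its `Primcodable` instance. -/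
def qenc (q : ℚ) : ℕ := @encode ℚ Primcodable.toEncodable q

theorem qenc_primrec : Primrec qenc := Primrec.encode

theorem qenc_inj {q r : ℚ} (h : qenc q = qenc r) : q = r :=
  @encode_injective ℚ Primcodable.toEncodable _ _ h

theorem ofNat_qenc (q : ℚ) : Denumerable.ofNat ℚ (qenc q) = q := Denumerable.ofNat_encode q

theorem qenc_ofNat (n : ℕ) : qenc (Denumerable.ofNat ℚ n) = n := Denumerable.encode_ofNat n

theorem ratEnc2 (q : ℚ) : qenc q =
    (List.range (ratIota q)).countP (fun m => @decide (m ∈ Set.range (@encode ℚ Rat.instEncodable))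
      (Encodable.decidableRangeEncode ℚ m)) := rfl

theorem ratR_iff (m : ℕ) : m ∈ Set.range (@encode ℚ Rat.instEncodable) ↔ RatR m := by
  constructor
  · rintro ⟨q, rfl⟩
    rw [ratEnc]
    simp only [RatR, ratIota, Nat.unpair_pair, natAbs_enc]
    exact ⟨q.pos, q.reduced⟩
  · rintro ⟨h1, h2⟩
    have hz : encode (Denumerable.ofNat ℤ m.unpair.1) = m.unpair.1 := Denumerable.encode_ofNat _
    refine ⟨⟨Denumerable.ofNat ℤ m.unpair.1, m.unpair.2, h1.ne', ?_⟩, ?_⟩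
    · rw [← natAbs_enc, hz]; exact h2
    · rw [ratEnc]; unfold ratIota
      simp only [hz, Nat.pair_unpair]

theorem ratR_primrec : PrimrecPred RatR := by
  have u1 : Primrec (fun m : ℕ => m.unpair.1) := Primrec.fst.comp Primrec.unpair
  have u2 : Primrec (fun m : ℕ => m.unpair.2) := Primrec.snd.comp Primrec.unpair
  have v1 : Primrec (fun m : ℕ => (m.unpair.1 + 1) / 2) :=
    Primrec.nat_div.comp (Primrec.succ.comp u1) (Primrec.const 2)
  have h : PrimrecRel (fun (k : ℕ) (m : ℕ) =>
      ¬ (((m.unpair.1 + 1) / 2) % k = 0 ∧ m.unpair.2 % k = 0) ∨ k = 1) := by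
    refine PrimrecPred.or (PrimrecPred.not (PrimrecPred.and ?_ ?_)) ?_
    · exact Primrec.eq.comp (Primrec.nat_mod.comp (v1.comp Primrec.snd) Primrec.fst)
        (Primrec.const 0)
    · exact Primrec.eq.comp (Primrec.nat_mod.comp (u2.comp Primrec.snd) Primrec.fst)
        (Primrec.const 0)
    · exact Primrec.eq.comp Primrec.fst (Primrec.const 1)
  have h3 : PrimrecPred (fun m : ℕ => ∀ k < m.unpair.2 + 1,
      ¬ (((m.unpair.1 + 1) / 2) % k = 0 ∧ m.unpair.2 % k = 0) ∨ k = 1) :=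
    h.forall_lt.comp (Primrec.succ.comp u2) Primrec.id
  have h4 : PrimrecPred (fun m : ℕ => 0 < m.unpair.2) := Primrec.nat_lt.comp (Primrec.const 0) u2
  refine (h4.and h3).of_eq ?_
  intro m
  unfold RatR
  refine and_congr_right fun hp => ?_
  generalize (m.unpair.1 + 1) / 2 = a at *
  generalize m.unpair.2 = d at *
  constructor
  · intro H
    have hg := Nat.gcd_le_right a hp
    rcases H (Nat.gcd a d) (by omega) with h | h
    · exact absurd ⟨Nat.mod_eq_zero_of_dvd (Nat.gcd_dvd_left _ _), Nat.mod_eq_zero_of_dvd (Nat.gcd_dvd_right _ _)⟩ h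
    · exact h
  · intro H k _
    by_contra! hk
    exact hk.2 (Nat.eq_one_of_dvd_coprimes H (Nat.dvd_of_mod_eq_zero hk.1.1) (Nat.dvd_of_mod_eq_zero hk.1.2))

def ratRank (m : ℕ) : ℕ := ((List.range m).filter (fun k => decide (RatR k))).length

theorem ratRank_primrec : Primrec ratRank :=
  Primrec.list_length.comp ((Primrec.listFilter ratR_primrec).comp Primrec.list_range)

theorem ratEnc3 (q : ℚ) : qenc q = ratRank (ratIota q) := by
  rw [ratEnc2, ratRank, List.countP_eq_length_filter]
  congr 2
  funext m
  simp only [ratR_iff]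

theorem ratR_iota (q : ℚ) : RatR (ratIota q) := (ratR_iff _).1 ⟨q, rfl⟩

theorem ratIota_computable : Computable ratIota := by
  have hp : Primrec₂ (fun (q : ℚ) (m : ℕ) => decide (RatR m ∧ ratRank m = qenc q)) := by
    refine PrimrecPred.decide (p := fun x : ℚ × ℕ => RatR x.2 ∧ ratRank x.2 = qenc x.1) (PrimrecPred.and (ratR_primrec.comp Primrec.snd) ?_)
    exact Primrec.eq.comp (ratRank_primrec.comp Primrec.snd) (qenc_primrec.comp Primrec.fst)
  refine (Partrec.rfind hp.to_comp.partrec₂).of_eq_tot fun q => ?_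
  have key : ∀ m, RatR m → ratRank m = qenc q → m = ratIota q := by
    intro m hm hr
    obtain ⟨q', rfl⟩ := (ratR_iff m).2 hm
    rw [ratEnc, ← ratEnc3] at hr
    rw [ratEnc, qenc_inj hr]
  obtain ⟨n, hn, -⟩ := Nat.rfind_min' (p := fun m => decide (RatR m ∧ ratRank m = qenc q)) (m := ratIota q)
    (by simp [ratR_iota, ratEnc3])
  have := Nat.rfind_spec hn
  rw [PFun.coe_val, Part.mem_some_iff, eq_comm, decide_eq_true_eq] at this
  have h2 := key n this.1 this.2
  rw [← h2]; exact hn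

def ratPos (q : ℚ) : ℕ := if (ratIota q).unpair.1 % 2 = 0 then (ratIota q).unpair.1 / 2 else 0
def ratNeg (q : ℚ) : ℕ := if (ratIota q).unpair.1 % 2 = 0 then 0 else (ratIota q).unpair.1 / 2 + 1

theorem rat_eq (q : ℚ) : q = ((ratPos q : ℚ) - ratNeg q) / q.den := by
  conv_lhs => rw [← Rat.num_div_den q]
  congr 1
  simp only [ratPos, ratNeg, ratIota, Nat.unpair_pair]
  generalize q.num = z
  cases z with
  | ofNat n =>
    have : encode (Int.ofNat n) = 2 * n := rfl
    rw [this]; simp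
  | negSucc n =>
    have : encode (Int.negSucc n) = 2 * n + 1 := rfl
    have h1 : (2 * n + 1) % 2 = 1 := by omega
    have h2 : (2 * n + 1) / 2 = n := by omega
    rw [this, h1, h2]; simp [Int.negSucc_eq]

theorem iota1 : Computable (fun q => (ratIota q).unpair.1) :=
  Computable.fst.comp (Computable.unpair.comp ratIota_computable)
theorem ratDen_computable : Computable (fun q : ℚ => q.den) :=
  (Computable.snd.comp (Computable.unpair.comp ratIota_computable)).of_eq fun q => by simp [ratIota]
theorem ratPos_computable : Computable ratPos := by
  have : Primrec (fun e : ℕ => if e % 2 = 0 then e / 2 else 0) :=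
    Primrec.ite (Primrec.eq.comp (Primrec.nat_mod.comp .id (.const 2)) (.const 0))
      (Primrec.nat_div.comp .id (.const 2)) (.const 0)
  exact this.to_comp.comp iota1
theorem ratNeg_computable : Computable ratNeg := by
  have : Primrec (fun e : ℕ => if e % 2 = 0 then 0 else e / 2 + 1) :=
    Primrec.ite (Primrec.eq.comp (Primrec.nat_mod.comp .id (.const 2)) (.const 0))
      (.const 0) (Primrec.succ.comp (Primrec.nat_div.comp .id (.const 2)))
  exact this.to_comp.comp iota1

theorem c_add {α} [Primcodable α] {f g : α → ℕ} (hf : Computable f) (hg : Computable g) :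
    Computable (fun a => f a + g a) := Primrec.nat_add.to_comp.comp hf hg
theorem c_mul {α} [Primcodable α] {f g : α → ℕ} (hf : Computable f) (hg : Computable g) :
    Computable (fun a => f a * g a) := Primrec.nat_mul.to_comp.comp hf hg

theorem rat_mk {α} [Primcodable α] {f g d : α → ℕ} (hf : Computable f) (hg : Computable g)
    (hd : Computable d) (hpos : ∀ a, 0 < d a) :
    Computable (fun a => ((f a : ℚ) - g a) / d a) := by
  have ho : Computable (fun x : α × ℕ => Denumerable.ofNat ℚ x.2) := (Computable.ofNat ℚ).comp Computable.snd
  have hp : Computable₂ (fun (x : α) (n : ℕ) =>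
      decide (f x * (Denumerable.ofNat ℚ n).den + ratNeg (Denumerable.ofNat ℚ n) * d x =
        g x * (Denumerable.ofNat ℚ n).den + ratPos (Denumerable.ofNat ℚ n) * d x)) := by
    have e : Computable₂ (fun (a b : ℕ) => decide (a = b)) := (PrimrecRel.decide Primrec.eq).to_comp
    refine Computable₂.comp (f := fun (a b : ℕ) => decide (a = b)) e ?_ ?_
    · exact c_add (c_mul (hf.comp .fst) (ratDen_computable.comp ho)) (c_mul (ratNeg_computable.comp ho) (hd.comp .fst))
    · exact c_add (c_mul (hg.comp .fst) (ratDen_computable.comp ho)) (c_mul (ratPos_computable.comp ho) (hd.comp .fst))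
  have key : ∀ a (q : ℚ), f a * q.den + ratNeg q * d a = g a * q.den + ratPos q * d a ↔
      q = ((f a : ℚ) - g a) / d a := by
    intro a q
    have h1 : (q.den : ℚ) ≠ 0 := by exact_mod_cast q.den_ne_zero
    have h2 : (d a : ℚ) ≠ 0 := by exact_mod_cast (hpos a).ne'
    conv_rhs => rw [rat_eq q]
    rw [div_eq_div_iff h1 h2, ← Nat.cast_inj (R := ℚ)]
    push_cast
    constructor <;> intro h <;> linarith
  have hr : Computable (fun a => qenc (((f a : ℚ) - g a) / d a)) := by
    refine Partrec.of_eq_tot (Partrec.rfind hp.partrec₂) fun a => ?_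
    obtain ⟨n, hn, -⟩ := Nat.rfind_min' (p := fun n =>
      decide (f a * (Denumerable.ofNat ℚ n).den + ratNeg (Denumerable.ofNat ℚ n) * d a =
        g a * (Denumerable.ofNat ℚ n).den + ratPos (Denumerable.ofNat ℚ n) * d a))
      (m := qenc (((f a : ℚ) - g a) / d a))
      (by rw [decide_eq_true_eq, key, ofNat_qenc])
    have := Nat.rfind_spec hn
    rw [PFun.coe_val, Part.mem_some_iff, eq_comm, decide_eq_true_eq, key] at this
    rw [← this, qenc_ofNat]; exact hn
  exact ((Computable.ofNat ℚ).comp hr).of_eq fun a => ofNat_qenc _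

theorem rat_add {α} [Primcodable α] {f g : α → ℚ} (hf : Computable f) (hg : Computable g) :
    Computable (fun a => f a + g a) := by
  have p1 := ratPos_computable.comp hf
  have n1 := ratNeg_computable.comp hf
  have d1 := ratDen_computable.comp hf
  have p2 := ratPos_computable.comp hg
  have n2 := ratNeg_computable.comp hg
  have d2 := ratDen_computable.comp hg
  refine (rat_mk (c_add (c_mul p1 d2) (c_mul p2 d1)) (c_add (c_mul n1 d2) (c_mul n2 d1)) (c_mul d1 d2)
    (fun a => Nat.mul_pos (Rat.den_pos _) (Rat.den_pos _))).of_eq fun a => ?_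
  have h1 : ((f a).den : ℚ) ≠ 0 := by exact_mod_cast (f a).den_ne_zero
  have h2 : ((g a).den : ℚ) ≠ 0 := by exact_mod_cast (g a).den_ne_zero
  conv_rhs => rw [rat_eq (f a), rat_eq (g a)]
  push_cast
  field_simp
  ring

theorem rat_mul {α} [Primcodable α] {f g : α → ℚ} (hf : Computable f) (hg : Computable g) :
    Computable (fun a => f a * g a) := by
  have p1 := ratPos_computable.comp hf
  have n1 := ratNeg_computable.comp hf
  have d1 := ratDen_computable.comp hf
  have p2 := ratPos_computable.comp hg
  have n2 := ratNeg_computable.comp hg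
  have d2 := ratDen_computable.comp hg
  refine (rat_mk (c_add (c_mul p1 p2) (c_mul n1 n2)) (c_add (c_mul p1 n2) (c_mul n1 p2)) (c_mul d1 d2)
    (fun a => Nat.mul_pos (Rat.den_pos _) (Rat.den_pos _))).of_eq fun a => ?_
  have h1 : ((f a).den : ℚ) ≠ 0 := by exact_mod_cast (f a).den_ne_zero
  have h2 : ((g a).den : ℚ) ≠ 0 := by exact_mod_cast (g a).den_ne_zero
  conv_rhs => rw [rat_eq (f a), rat_eq (g a)]
  push_cast
  field_simp
  ring

theorem rat_sub {α} [Primcodable α] {f g : α → ℚ} (hf : Computable f) (hg : Computable g) :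
    Computable (fun a => f a - g a) :=
  (rat_add hf (rat_mul (Computable.const (-1)) hg)).of_eq fun a => by ring

theorem rat_sum {α ι} [Primcodable α] (s : Finset ι) {f : ι → α → ℚ} (hf : ∀ i, Computable (f i)) :
    Computable (fun a => ∑ i ∈ s, f i a) := by
  classical
  induction s using Finset.induction_on with
  | empty => simpa using Computable.const (0 : ℚ)
  | insert i s hi ih =>
    simp only [Finset.sum_insert hi]
    exact rat_add (hf i) ih

/-- state: (power, sum) -/
def nmlAux (x : ℚ) (K : ℕ) : ℚ × ℚ :=
  Nat.rec (1, 0) (fun k s => (s.1 * (1 - x), s.2 + s.1 * (1 - x) * ((1 - 0) / ((k + 1 : ℕ) : ℚ)))) K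

theorem nmlAux_eq (x : ℚ) (K : ℕ) :
    nmlAux x K = ((1 - x) ^ K, ∑ k ∈ Finset.range K, (1 - x) ^ (k + 1) / ((k : ℚ) + 1)) := by
  induction K with
  | zero => simp [nmlAux]
  | succ K ih =>
    have : nmlAux x (K + 1) = ((nmlAux x K).1 * (1 - x), (nmlAux x K).2 + (nmlAux x K).1 * (1 - x) * ((1 - 0) / ((K + 1 : ℕ) : ℚ))) := rfl
    rw [this, ih, Finset.sum_range_succ]
    simp only [Prod.mk.injEq]
    constructor
    · ring
    · push_cast; ring

def nmlApx (x : ℚ) (K : ℕ) : ℚ := x * ∑ k ∈ Finset.range K, (1 - x) ^ (k + 1) / ((k : ℚ) + 1)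

theorem nmlApx_computable {α} [Primcodable α] {f : α → ℚ} {g : α → ℕ} (hf : Computable f) (hg : Computable g) :
    Computable (fun a => nmlApx (f a) (g a)) := by
  have h : Computable (fun a => nmlAux (f a) (g a)) := by
    refine Computable.nat_rec (h := fun a (ks : ℕ × (ℚ × ℚ)) => (ks.2.1 * (1 - f a), ks.2.2 + ks.2.1 * (1 - f a) * ((1 - 0) / ((ks.1 + 1 : ℕ) : ℚ)))) hg (Computable.const (1, 0)) ?_
    have c1 : Computable (fun x : α × (ℕ × (ℚ × ℚ)) => x.2.2.1 * (1 - f x.1)) :=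
      rat_mul (Computable.fst.comp (Computable.snd.comp .snd)) (rat_sub (.const 1) (hf.comp .fst))
    have c2 : Computable (fun x : α × (ℕ × (ℚ × ℚ)) => ((1 - 0) / ((x.2.1 + 1 : ℕ) : ℚ))) := by
      refine (rat_mk (f := fun _ => 1) (g := fun _ => 0) (.const 1) (.const 0)
        (Computable.succ.comp (Computable.fst.comp .snd)) (fun _ => Nat.succ_pos _)).of_eq fun a => ?_
      simp
    exact c1.pair (rat_add (Computable.snd.comp (Computable.snd.comp .snd)) (rat_mul c1 c2))
  refine (rat_mul hf (Computable.snd.comp h)).of_eq fun a => ?_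
  rw [nmlAux_eq]; rfl

theorem nmlApx_err (x : ℚ) (K : ℕ) (h0 : (0 : ℝ) ≤ x) (h1 : (x : ℝ) ≤ 1) :
    |(nmlApx x K : ℝ) - Real.negMulLog x| ≤ 1 / ((K : ℝ) + 1) := by
  have hK : (0 : ℝ) < (K : ℝ) + 1 := by positivity
  unfold nmlApx
  push_cast
  generalize (x : ℝ) = t at *
  rcases h0.eq_or_lt with rfl | hpos
  · simp; positivity
  have hlog := Real.hasSum_pow_div_log_of_abs_lt_one (x := 1 - t) (by rw [abs_lt]; constructor <;> linarith)
  rw [sub_sub_cancel] at hlog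
  have htail := (hasSum_nat_add_iff' K).2 hlog
  have hgeo := (hasSum_geometric_of_lt_one (r := 1 - t) (by linarith) (by linarith)).mul_left (1 / ((K : ℝ) + 1))
  rw [sub_sub_cancel] at hgeo
  have hy0 : 0 ≤ 1 - t := by linarith
  have hub := hasSum_le (fun k => ?_) htail hgeo
  · have hlb := htail.nonneg (fun k => by positivity)
    rw [abs_le, Real.negMulLog]
    have e : t * (1 / ((K : ℝ) + 1) * t⁻¹) = 1 / ((K : ℝ) + 1) := by field_simp
    have hub' := mul_le_mul_of_nonneg_left hub hpos.le
    have hlb' := mul_nonneg hpos.le hlb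
    rw [e] at hub'
    have : 0 ≤ 1 / ((K : ℝ) + 1) := by positivity
    constructor <;> nlinarith
  · rw [one_div, mul_comm, ← div_eq_mul_inv]
    refine div_le_div₀ (by positivity) (pow_le_pow_of_le_one hy0 (by linarith) (by omega)) hK ?_
    push_cast; linarith [(Nat.cast_nonneg k : (0 : ℝ) ≤ k)]

theorem proj_computable (a b c : ℕ) (g : Fin a × Fin b × Fin c) :
    Computable (fun p : Fin a × Fin b × Fin c → ℚ => p g) := by
  let e : (Fin a × Fin b × Fin c → ℚ) ≃ (Fin (a * (b * c)) → ℚ) := (Equiv.arrowCongr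
      (((Equiv.prodCongr (Equiv.refl (Fin a)) finProdFinEquiv).trans finProdFinEquiv))
      (Equiv.refl ℚ))
  have h : Primrec e := Primrec.of_equiv (e := e)
  let i : Fin (a * (b * c)) :=
    ((Equiv.prodCongr (Equiv.refl (Fin a)) finProdFinEquiv).trans finProdFinEquiv) g
  have h2 : Primrec (fun p => e p i) := Primrec.fin_app.comp h (Primrec.const i)
  refine h2.to_comp.of_eq fun p => ?_
  change p (((Equiv.prodCongr (Equiv.refl (Fin a)) finProdFinEquiv).trans
    finProdFinEquiv).symm i) = p g
  rw [Equiv.symm_apply_apply]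

theorem sum_err {ι : Type*} [Fintype ι] (x : ι → ℚ) (K : ℕ)
    (h : ∀ i, (0 : ℝ) ≤ x i ∧ (x i : ℝ) ≤ 1) :
    |∑ i, (nmlApx (x i) K : ℝ) - ∑ i, Real.negMulLog (x i)| ≤
      Fintype.card ι * (1 / ((K : ℝ) + 1)) := by
  rw [← Finset.sum_sub_distrib]
  refine (Finset.abs_sum_le_sum_abs _ _).trans ?_
  refine (Finset.sum_le_sum fun i _ => nmlApx_err _ K (h i).1 (h i).2).trans ?_
  simp

/-- Conditional mutual information of a rational-valued joint probability mass function
on `Fin a × Fin b × Fin c` can be approximated to within any prescribed accuracy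
`1 / (n + 1)` by a computable function. -/
theorem condMutualInfo_computably_approximable (a b c : ℕ) :
    ∃ f : (Fin a × Fin b × Fin c → ℚ) × ℕ → ℚ, Computable f ∧
      ∀ p : Fin a × Fin b × Fin c → ℚ,
        (∀ g, (0 : ℝ) ≤ (p g : ℝ)) → (∑ g, (p g : ℝ)) = 1 →
        ∀ n : ℕ,
          |(f (p, n) : ℝ) - condMutualInfo (fun g => (p g : ℝ))| ≤ 1 / (n + 1) := by
  let T : ℕ := a * c + b * c + c + a * (b * c)
  let F : (Fin a × Fin b × Fin c → ℚ) → ℕ → ℚ := fun p K =>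
    (∑ i : Fin a × Fin c, nmlApx (∑ y, p (i.1, y, i.2)) K) +
    (∑ i : Fin b × Fin c, nmlApx (∑ x, p (x, i.1, i.2)) K) -
    (∑ z, nmlApx (∑ i : Fin a × Fin b, p (i.1, i.2, z)) K) -
    (∑ g, nmlApx (p g) K)
  refine ⟨fun x => F x.1 (T * (x.2 + 1)), ?_, ?_⟩
  · have hK : Computable (fun x : (Fin a × Fin b × Fin c → ℚ) × ℕ => T * (x.2 + 1)) :=
      c_mul (.const T) (Computable.succ.comp .snd)
    have hp : ∀ g, Computable (fun x : (Fin a × Fin b × Fin c → ℚ) × ℕ => x.1 g) :=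
      fun g => (proj_computable a b c g).comp .fst
    refine rat_sub (rat_sub (rat_add ?_ ?_) ?_) ?_
    · exact rat_sum _ fun i => nmlApx_computable (rat_sum _ fun _ => hp _) hK
    · exact rat_sum _ fun i => nmlApx_computable (rat_sum _ fun _ => hp _) hK
    · exact rat_sum _ fun i => nmlApx_computable (rat_sum _ fun _ => hp _) hK
    · exact rat_sum _ fun i => nmlApx_computable (hp _) hK
  · intro p h0 h1 n
    have marg : ∀ {κ : Type} [Fintype κ] (φ : κ → Fin a × Fin b × Fin c),
        Function.Injective φ → (0 : ℝ) ≤ ((∑ k, p (φ k) : ℚ) : ℝ) ∧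
          ((∑ k, p (φ k) : ℚ) : ℝ) ≤ 1 := by
      intro κ _ φ hφ
      push_cast
      refine ⟨Finset.sum_nonneg fun _ _ => h0 _, ?_⟩
      have hm := Finset.sum_map Finset.univ ⟨φ, hφ⟩ (fun g => (p g : ℝ))
      simp only [Function.Embedding.coeFn_mk] at hm
      rw [← h1, ← hm]
      exact Finset.sum_le_sum_of_subset_of_nonneg (Finset.subset_univ _) fun g _ _ => h0 g
    generalize hKd : T * (n + 1) = K
    have e1 := sum_err (fun i : Fin a × Fin c => ∑ y, p (i.1, y, i.2)) K
      (fun i => marg (fun y => (i.1, y, i.2)) fun y y' h => by simpa using h)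
    have e2 := sum_err (fun i : Fin b × Fin c => ∑ x, p (x, i.1, i.2)) K
      (fun i => marg (fun x => (x, i.1, i.2)) fun y y' h => by simpa using h)
    have e3 := sum_err (fun z : Fin c => ∑ i : Fin a × Fin b, p (i.1, i.2, z)) K
      (fun z => marg (fun i : Fin a × Fin b => (i.1, i.2, z)) fun y y' h => by
        simpa [Prod.ext_iff] using h)
    have e4 := sum_err (fun g => p g) K
      (fun g => by simpa using marg (fun _ : Unit => g) fun _ _ _ => rfl)
    have hT : (T : ℝ) * (1 / ((K : ℝ) + 1)) ≤ 1 / ((n : ℝ) + 1) := by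
      rw [← hKd, mul_one_div, div_le_div_iff₀ (by positivity) (by positivity)]
      push_cast; linarith
    simp only [Fintype.card_prod, Fintype.card_fin] at e1 e2 e3 e4
    have hTe : (T : ℝ) = a * c + b * c + c + a * (b * c) := by simp [T]
    push_cast at e1 e2 e3 e4
    rw [hTe] at hT
    simp only [F, hKd]
    push_cast
    unfold condMutualInfo
    simp only [Fintype.sum_prod_type] at e1 e2 e3 e4 ⊢
    rw [abs_le] at *
    constructor <;> linarith [e1.1, e1.2, e2.1, e2.2, e3.1, e3.2, e4.1, e4.2]
end
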